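/- Let β ∈ V_1 ⊖ S_1 and let m, n, m', n' ≥ 0 be integers with m + n = m' + n'. Then q_1(h_{m'}(h_{n'}^r(β_{m,n}))) = (−1)^{|n−n'|}·(L−1)^{m+n−|n−n'|}·β. -/

import Mathlib

noncomputable section

open scoped ComplexInnerProductSpace

namespace UCoxMasa

/-- The universal Coxeter matrix on `Fin L`: all off-diagonal entries are `0` (representing ∞). -/
def Mat (L : ℕ) : CoxeterMatrix (Fin L) where
  M := fun i j => if i = j then 1 else 0
  isSymm := by
    ext i j
    by_cases h : i = j <;> simp [Matrix.transpose, h, eq_comm]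
  diagonal := fun i => by simp
  off_diagonal := fun i j h => by simp [h]

/-- The universal Coxeter group on `L` generators: free product of `L` copies of `ℤ/2ℤ`. -/
abbrev W (L : ℕ) : Type := (Mat L).Group

/-- The distinguished Coxeter system of `W L`. -/
def cs (L : ℕ) : CoxeterSystem (Mat L) (W L) := CoxeterMatrix.toCoxeterSystem (Mat L)

/-- The simple reflection associated to `i : Fin L`. -/
def σ {L : ℕ} (i : Fin L) : W L := (cs L).simple i

/-- Word length on `W L` with respect to the generating set of simple reflections. -/
def len {L : ℕ} (w : W L) : ℕ := (cs L).length w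

/-- The Hilbert space `ℓ²(W)`. -/
abbrev H (L : ℕ) : Type := lp (fun _ : W L => ℂ) 2

/-- The standard orthonormal basis vector `δ_w` of `ℓ²(W)`. -/
def δ {L : ℕ} (w : W L) : H L :=
  letI := Classical.decEq (W L)
  lp.single 2 w 1

/-- `V l`: the linear span of `{δ_w : ℓ(w) = l}`. -/
def V (L : ℕ) (l : ℕ) : Submodule ℂ (H L) :=
  Submodule.span ℂ {x : H L | ∃ w : W L, len w = l ∧ x = δ w}

/-- `S_l`: the linear span of `q_l(h V_{l-1}) ∪ q_l(R_h V_{l-1})`,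
given the projections `Q`, the operator `h` and the right operator `Rh`. -/
def Sl (L : ℕ) (Q : ℕ → (H L →L[ℂ] H L)) (h Rh : H L →L[ℂ] H L) (l : ℕ) :
    Submodule ℂ (H L) :=
  Submodule.span ℂ
    ({x : H L | ∃ y ∈ V L (l - 1), x = Q l (h y)} ∪
      {x : H L | ∃ y ∈ V L (l - 1), x = Q l (Rh y)})

end UCoxMasa


namespace UCoxMasa

variable {L : ℕ}

/-- A word is alternating if no two consecutive letters coincide. -/
def Alternating (l : List (Fin L)) : Prop := l.IsChain (· ≠ ·)

lemma σ_mul_σ_mul (s : Fin L) (w : W L) : σ s * (σ s * w) = w :=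
  (cs L).simple_mul_simple_cancel_left s

lemma inv_σ (s : Fin L) : (σ s : W L)⁻¹ = σ s := (cs L).inv_simple s

lemma len_inv (w : W L) : len w⁻¹ = len w := (cs L).length_inv w

lemma len_σ_mul (s : Fin L) (w : W L) : len (σ s * w) = len w + 1 ∨ len (σ s * w) + 1 = len w :=
  (cs L).length_simple_mul w s

lemma len_mul_σ (w : W L) (s : Fin L) : len (w * σ s) = len w + 1 ∨ len (w * σ s) + 1 = len w :=
  (cs L).length_mul_simple w s

/-- Left multiplication by a generator, on alternating words. -/
def letterAct (s : Fin L) (l : {l : List (Fin L) // Alternating l}) :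
    {l : List (Fin L) // Alternating l} :=
  if h : l.1.head? = some s then ⟨l.1.tail, l.2.tail⟩
  else ⟨s :: l.1, List.isChain_cons.2 ⟨fun y hy e => h (by rw [e]; exact hy), l.2⟩⟩

lemma letterAct_letterAct (s : Fin L) (l : {l : List (Fin L) // Alternating l}) :
    letterAct s (letterAct s l) = l := by
  obtain ⟨l, hl⟩ := l
  cases l with
  | nil => simp [letterAct]
  | cons a l =>
    by_cases h : a = s
    · subst h
      have : l.head? ≠ some a := fun e => (List.isChain_cons.1 hl).1 a e rfl
      simp [letterAct, this]
    · simp [letterAct, h]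

/-- `letterAct` as an element of the endomorphism monoid. -/
def letterEnd (s : Fin L) : Function.End {l : List (Fin L) // Alternating l} := letterAct s

lemma isLiftable_letterEnd : (Mat L).IsLiftable (letterEnd (L := L)) := by
  intro i j
  by_cases h : i = j
  · subst h
    rw [(Mat L).diagonal, pow_one]
    funext l
    exact letterAct_letterAct i l
  · have : (Mat L).M i j = 0 := by simp [Mat, h]
    rw [this, pow_zero]

/-- The action of `W L` on alternating words. -/
def wordAct (L : ℕ) : W L →* Function.End {l : List (Fin L) // Alternating l} :=
  (cs L).lift ⟨letterEnd, isLiftable_letterEnd⟩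

lemma wordAct_σ (s : Fin L) : wordAct L (σ s) = letterEnd s :=
  (cs L).lift_apply_simple isLiftable_letterEnd s

lemma wordAct_σ_mul (s : Fin L) (w : W L) (l : {l : List (Fin L) // Alternating l}) :
    wordAct L (σ s * w) l = letterAct s (wordAct L w l) := by
  rw [map_mul, wordAct_σ]
  rfl

lemma length_letterAct_le (s : Fin L) (l : {l : List (Fin L) // Alternating l}) :
    (letterAct s l).1.length ≤ l.1.length + 1 := by
  unfold letterAct
  split_ifs
  · simp; omega
  · simp

lemma wordAct_wordProd (l : List (Fin L)) (hl : Alternating l) :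
    wordAct L ((cs L).wordProd l) ⟨[], List.isChain_nil⟩ = ⟨l, hl⟩ := by
  induction l with
  | nil => rw [CoxeterSystem.wordProd_nil, map_one]; rfl
  | cons a l ih =>
    have h : l.head? ≠ some a := fun e => (List.isChain_cons.1 hl).1 a e rfl
    rw [CoxeterSystem.wordProd_cons]
    erw [wordAct_σ_mul]
    rw [ih hl.tail]
    simp [letterAct, h]

lemma length_wordAct_wordProd_le (l : List (Fin L)) :
    (wordAct L ((cs L).wordProd l) ⟨[], List.isChain_nil⟩).1.length ≤ l.length := by
  induction l with
  | nil => rw [CoxeterSystem.wordProd_nil, map_one]; rfl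
  | cons a l ih =>
    rw [CoxeterSystem.wordProd_cons]
    erw [wordAct_σ_mul]
    exact (length_letterAct_le _ _).trans (by simpa using ih)

lemma len_wordProd {l : List (Fin L)} (hl : Alternating l) :
    len ((cs L).wordProd l) = l.length := by
  apply le_antisymm ((cs L).length_wordProd_le l)
  obtain ⟨k, hk, e⟩ := (cs L).exists_isReduced ((cs L).wordProd l)
  have h := length_wordAct_wordProd_le k
  rw [← e, wordAct_wordProd l hl] at h
  rw [e]
  exact h.trans hk.symm.le

lemma exists_alternating (w : W L) : ∃ l, Alternating l ∧ w = (cs L).wordProd l := by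
  refine (cs L).simple_induction_left
    (p := fun w => ∃ l, Alternating l ∧ w = (cs L).wordProd l) w ⟨[], List.isChain_nil, by simp⟩ ?_
  rintro _ s ⟨l, hl, rfl⟩
  by_cases h : l.head? = some s
  · obtain ⟨k, rfl⟩ : ∃ k, l = s :: k := by
      cases l <;> simp_all
    exact ⟨k, hl.tail, by simp [CoxeterSystem.wordProd_cons]⟩
  · exact ⟨s :: l, List.isChain_cons.2 ⟨fun y hy e => h (by rw [e]; exact hy), hl⟩,
      by simp [CoxeterSystem.wordProd_cons]⟩

lemma left_descent_unique {w : W L} {s t : Fin L} (hs : len (σ s * w) < len w)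
    (ht : len (σ t * w) < len w) : s = t := by
  obtain ⟨l, hl, rfl⟩ := exists_alternating w
  have key : ∀ u : Fin L, len (σ u * (cs L).wordProd l) < len ((cs L).wordProd l) →
      l.head? = some u := by
    intro u hu
    by_contra h
    have hc : Alternating (u :: l) :=
      List.isChain_cons.2 ⟨fun y hy e => h (by rw [e]; exact hy), hl⟩
    have := len_wordProd hc
    rw [CoxeterSystem.wordProd_cons] at this
    rw [len_wordProd hl, σ, this] at hu
    simp at hu
  simpa using (key s hs).symm.trans (key t ht)

lemma exists_left_descent {w : W L} (hw : w ≠ 1) : ∃ s, len (σ s * w) < len w :=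
  (cs L).exists_leftDescent_of_ne_one hw

lemma len_σ_mul_mul_σ {w : W L} (hw : 2 ≤ len w) (s t : Fin L) :
    (len (σ s * w * σ t) : ℤ) + len w = len (σ s * w) + len (w * σ t) := by
  obtain ⟨l, hl, rfl⟩ := exists_alternating w
  rw [len_wordProd hl] at hw ⊢
  obtain ⟨a, k, b, rfl⟩ : ∃ a k b, l = a :: (k ++ [b]) := by
    cases l with
    | nil => simp at hw
    | cons a l =>
      refine ⟨a, l.dropLast, l.getLast (by rintro rfl; simp at hw), ?_⟩
      rw [List.dropLast_append_getLast]
  have e1 : ∀ u : Fin L, σ u * (cs L).wordProd (a :: (k ++ [b]))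
      = (cs L).wordProd (u :: a :: (k ++ [b])) := fun u => ((cs L).wordProd_cons _ _).symm
  have e2 : ∀ (l : List (Fin L)) (u : Fin L), (cs L).wordProd l * σ u
      = (cs L).wordProd (l ++ [u]) := fun l u => by
    simp [CoxeterSystem.wordProd_append, σ]
  have c1 : ∀ l : List (Fin L), (cs L).wordProd (a :: a :: l) = (cs L).wordProd l := fun l => by
    simp [CoxeterSystem.wordProd_cons]
  have c2 : ∀ l : List (Fin L), (cs L).wordProd (l ++ [b, b]) = (cs L).wordProd l := fun l => by
    simp [CoxeterSystem.wordProd_append, CoxeterSystem.wordProd_cons]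
  have hk : Alternating (a :: (k ++ [b])) := hl
  have hk1 : Alternating (k ++ [b]) := hl.tail
  have hk2 : Alternating (a :: k) := by
    have : (a :: k) ++ [b] = a :: (k ++ [b]) := rfl
    exact (List.isChain_append.1 (this ▸ hl)).1
  have hk3 : Alternating k := hk2.tail
  have app : ∀ (l : List (Fin L)) (t : Fin L), t ≠ b → Alternating (l ++ [b]) →
      Alternating (l ++ [b, t]) := by
    intro l t ht h
    rw [Alternating, List.isChain_append_cons_cons]
    exact ⟨h, ht.symm, List.isChain_singleton t⟩
  have con : ∀ (l : List (Fin L)) (s : Fin L), s ≠ a → Alternating (a :: l) →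
      Alternating (s :: a :: l) := fun l s hs h => List.isChain_cons_cons.2 ⟨hs, h⟩
  rw [e1, e2, e2]
  have r1 : ∀ (x : List (Fin L)) , x ++ [b] ++ [t] = x ++ [b, t] := by simp
  have r2 : s :: a :: (k ++ [b]) ++ [t] = s :: a :: (k ++ [b, t]) := by simp
  have r3 : a :: (k ++ [b]) ++ [t] = a :: (k ++ [b, t]) := by simp
  rw [r2, r3]
  have hka := fun ht => app (a :: k) t ht hk
  have hkb := fun ht => app k t ht hk1
  simp only [List.cons_append] at hka hkb
  have d2 : (cs L).wordProd (a :: (k ++ [b, b])) = (cs L).wordProd (a :: k) := c2 (a :: k)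
  have d3 : (cs L).wordProd (s :: a :: (k ++ [b, b])) = (cs L).wordProd (s :: a :: k) :=
    c2 (s :: a :: k)
  by_cases hs : s = a <;> by_cases ht : t = b
  · subst hs ht
    rw [c1, c1, c2, d2, len_wordProd hk3, len_wordProd hk1, len_wordProd hk2]
    simp; ring
  · subst hs
    rw [c1, c1, len_wordProd (hkb ht), len_wordProd (hka ht), len_wordProd hk1]
    simp; ring
  · subst ht
    rw [d2, d3, len_wordProd hk2, len_wordProd (con _ s hs hk2), len_wordProd (con _ s hs hk)]
    simp; ring
  · rw [len_wordProd (con _ s hs (hka ht)), len_wordProd (hka ht), len_wordProd (con _ s hs hk)]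
    simp; ring

lemma finite_sphere (L n : ℕ) : {w : W L | len w = n}.Finite := by
  refine ((List.finite_length_eq (Fin L) n).image (cs L).wordProd).subset ?_
  rintro w rfl
  obtain ⟨l, hl, rfl⟩ := exists_alternating w
  exact ⟨l, (len_wordProd hl).symm, rfl⟩

lemma len_σ (s : Fin L) : len (σ s) = 1 := (cs L).length_simple s

lemma len_one : len (1 : W L) = 0 := (cs L).length_one

lemma len_eq_zero {w : W L} : len w = 0 ↔ w = 1 := (cs L).length_eq_zero_iff

lemma len_eq_one {w : W L} : len w = 1 ↔ ∃ s, w = σ s := (cs L).length_eq_one_iff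

lemma σ_injective : Function.Injective (σ : Fin L → W L) := by
  intro s t h
  apply left_descent_unique (w := σ t)
  · rw [h]
    have := σ_mul_σ_mul t (1 : W L)
    simp only [mul_one] at this
    rw [this, len_one, len_σ]
    exact one_pos
  · have := σ_mul_σ_mul t (1 : W L)
    simp only [mul_one] at this
    rw [this, len_one, len_σ]
    exact one_pos

/-- The sphere of radius `n` in `W L`. -/
def sphere (L n : ℕ) : Finset (W L) := (finite_sphere L n).toFinset

lemma mem_sphere {n : ℕ} {w : W L} : w ∈ sphere L n ↔ len w = n := by
  simp [sphere]


section Filtration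

variable (d : W L → H L) (T : Fin L → H L →L[ℂ] H L) (Tw : W L → H L →L[ℂ] H L)
  (hn : ℕ → H L →L[ℂ] H L) (Q : ℕ → H L →L[ℂ] H L) (p : ℂ)

/-- The span of the vectors `d w` with `z * len w ≤ c`; for `z = 1` this bounds the length from
above, for `z = -1` from below. -/
def filt (z c : ℤ) : Submodule ℂ (H L) := Submodule.span ℂ (d '' {w | z * len w ≤ c})

/-- The combinatorial space of finitely supported functions on the sphere of radius `l`. -/
def grade (L l : ℕ) : Submodule ℂ (W L →₀ ℂ) :=
  Submodule.span ℂ ((fun w => Finsupp.single w 1) '' {w | len w = l})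

/-- The map sending `w` to the sum of all `s w` with `len (s w) = len w + z`. -/
def leftShift (L : ℕ) (z : ℤ) : (W L →₀ ℂ) →ₗ[ℂ] (W L →₀ ℂ) :=
  Finsupp.linearCombination ℂ fun w => ∑ s : Fin L,
    if (len (σ s * w) : ℤ) = len w + z then Finsupp.single (σ s * w) 1 else 0

variable {d T Tw hn Q p}

lemma mem_filt {z c : ℤ} {w : W L} (h : z * len w ≤ c) : d w ∈ filt d z c :=
  Submodule.subset_span ⟨w, h, rfl⟩

lemma generator_mem_filt
    (hT : ∀ (s : Fin L) (w : W L), T s (d w) =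
      if len (σ s * w) < len w then d (σ s * w) + p • d w else d (σ s * w))
    {z : ℤ} (hz : z = 1 ∨ z = -1) {c : ℤ} (s : Fin L) {y : H L} (hy : y ∈ filt d z c) :
    T s y ∈ filt d z (c + 1) := by
  refine Submodule.span_le (p := (filt d z (c + 1)).comap (T s).toLinearMap).2 ?_ hy
  rintro _ ⟨w, hw, rfl⟩
  simp only [Set.mem_ofPred_eq] at hw
  have h1 : d (σ s * w) ∈ filt d z (c + 1) := by
    apply mem_filt
    rcases len_σ_mul s w with h | h <;> rcases hz with rfl | rfl <;> omega
  have h2 : d w ∈ filt d z (c + 1) := mem_filt (by omega)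
  change T s (d w) ∈ filt d z (c + 1)
  rw [hT]
  split_ifs
  · exact add_mem h1 (Submodule.smul_mem _ _ h2)
  · exact h1

lemma word_mem_filt
    (hT : ∀ (s : Fin L) (w : W L), T s (d w) =
      if len (σ s * w) < len w then d (σ s * w) + p • d w else d (σ s * w))
    (hTw1 : Tw 1 = 1)
    (hTw : ∀ (s : Fin L) (w : W L), len (σ s * w) < len w → Tw w = T s ∘L Tw (σ s * w))
    {z : ℤ} (hz : z = 1 ∨ z = -1) {c : ℤ} {y : H L} (hy : y ∈ filt d z c) (m : ℕ) :
    ∀ w : W L, len w = m → Tw w y ∈ filt d z (c + m) := by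
  induction m with
  | zero =>
    intro w hw
    rw [len_eq_zero.1 hw, hTw1]
    simpa using hy
  | succ m ih =>
    intro w hw
    obtain ⟨s, hs⟩ := exists_left_descent (w := w) (by rintro rfl; simp [len_one] at hw)
    have hl : len (σ s * w) = m := by rcases len_σ_mul s w with h | h <;> omega
    rw [hTw s w hs]
    have := generator_mem_filt hT hz s (ih _ hl)
    push_cast
    rw [← add_assoc]
    exact this

lemma sphereSum_mem_filt
    (hT : ∀ (s : Fin L) (w : W L), T s (d w) =
      if len (σ s * w) < len w then d (σ s * w) + p • d w else d (σ s * w))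
    (hTw1 : Tw 1 = 1)
    (hTw : ∀ (s : Fin L) (w : W L), len (σ s * w) < len w → Tw w = T s ∘L Tw (σ s * w))
    (hhn : ∀ n, hn n = ∑ w ∈ sphere L n, Tw w)
    {z : ℤ} (hz : z = 1 ∨ z = -1) {c : ℤ} {y : H L} (hy : y ∈ filt d z c) (m : ℕ) :
    hn m y ∈ filt d z (c + m) := by
  rw [hhn, _root_.sum_apply]
  exact sum_mem fun w hw => word_mem_filt hT hTw1 hTw hz hy m w (mem_sphere.1 hw)

lemma sphereSum_succ
    (hTw : ∀ (s : Fin L) (w : W L), len (σ s * w) < len w → Tw w = T s ∘L Tw (σ s * w))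
    (m : ℕ) :
    ∑ v ∈ sphere L (m + 1), Tw v =
      ∑ w ∈ sphere L m, ∑ s, if len (σ s * w) < len w then 0 else T s ∘L Tw w := by
  classical
  have h1 : ∀ w ∈ sphere L m, (∑ s, if len (σ s * w) < len w then 0 else T s ∘L Tw w) =
      ∑ s ∈ Finset.univ.filter (fun s => ¬ len (σ s * w) < len w), T s ∘L Tw w := by
    intro w _
    rw [Finset.sum_filter]
    exact Finset.sum_congr rfl fun s _ => by split_ifs <;> rfl
  rw [Finset.sum_congr rfl h1, Finset.sum_sigma']
  symm
  refine Finset.sum_bij (fun x _ => σ x.2 * x.1) ?_ ?_ ?_ ?_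
  · rintro ⟨w, s⟩ h
    simp only [Finset.mem_sigma, Finset.mem_filter, mem_sphere, Finset.mem_univ, true_and] at h ⊢
    rcases len_σ_mul s w with h' | h' <;> omega
  · rintro ⟨w, s⟩ h ⟨w', s'⟩ h' e
    simp only [Finset.mem_sigma, Finset.mem_filter, mem_sphere, Finset.mem_univ, true_and]
      at h h' e
    have hs : s = s' := by
      apply left_descent_unique (w := σ s * w)
      · rw [σ_mul_σ_mul]; rcases len_σ_mul s w with h' | h' <;> omega
      · rw [e, σ_mul_σ_mul]; rcases len_σ_mul s' w' with h' | h' <;> omega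
    subst hs
    rw [mul_left_cancel e]
  · intro v hv
    rw [mem_sphere] at hv
    obtain ⟨s, hs⟩ := exists_left_descent (w := v) (by rintro rfl; simp [len_one] at hv)
    refine ⟨⟨σ s * v, s⟩, ?_, σ_mul_σ_mul s v⟩
    simp only [Finset.mem_sigma, Finset.mem_filter, mem_sphere, Finset.mem_univ, true_and,
      σ_mul_σ_mul]
    rcases len_σ_mul s v with h' | h' <;> omega
  · rintro ⟨w, s⟩ h
    simp only [Finset.mem_sigma, Finset.mem_filter, mem_sphere, Finset.mem_univ, true_and] at h
    rw [hTw s (σ s * w) (by rw [σ_mul_σ_mul]; rcases len_σ_mul s w with h' | h' <;> omega),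
      σ_mul_σ_mul]

lemma sum_sphereSum_sub_mem_filt
    (hT : ∀ (s : Fin L) (w : W L), T s (d w) =
      if len (σ s * w) < len w then d (σ s * w) + p • d w else d (σ s * w))
    (hTw1 : Tw 1 = 1)
    (hTw : ∀ (s : Fin L) (w : W L), len (σ s * w) < len w → Tw w = T s ∘L Tw (σ s * w))
    (hhn : ∀ n, hn n = ∑ w ∈ sphere L n, Tw w)
    {z : ℤ} (hz : z = 1 ∨ z = -1) {c : ℤ} {y : H L} (hy : y ∈ filt d z c) (m : ℕ) :
    (∑ s, T s) (hn m y) - hn (m + 1) y ∈ filt d z (c + m) := by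
  have e : (∑ s, T s) (hn m y) - hn (m + 1) y =
      ∑ w ∈ sphere L m, ∑ s, if len (σ s * w) < len w then T s (Tw w y) else 0 := by
    rw [hhn, hhn, sphereSum_succ hTw]
    simp only [_root_.sum_apply, map_sum]
    rw [← Finset.sum_sub_distrib]
    refine Finset.sum_congr rfl fun w _ => ?_
    rw [← Finset.sum_sub_distrib]
    refine Finset.sum_congr rfl fun s _ => ?_
    split_ifs <;> simp
  rw [e]
  refine sum_mem fun w hw => sum_mem fun s _ => ?_
  split_ifs with hs
  · rw [mem_sphere] at hw
    obtain ⟨k, rfl⟩ : ∃ k, m = k + 1 := ⟨m - 1, by omega⟩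
    have hl : len (σ s * w) = k := by rcases len_σ_mul s w with h | h <;> omega
    rw [hTw s w hs]
    have h0 := word_mem_filt hT hTw1 hTw hz hy k _ hl
    refine Submodule.span_le
      (p := (filt d z (c + (k + 1 : ℕ))).comap ((T s) ∘L (T s)).toLinearMap).2 ?_ h0
    rintro _ ⟨v, hv, rfl⟩
    change T s (T s (d v)) ∈ filt d z (c + (k + 1 : ℕ))
    simp only [Set.mem_ofPred_eq] at hv
    have a1 : d v ∈ filt d z (c + (k + 1 : ℕ)) := mem_filt (by push_cast; omega)
    have a2 : d (σ s * v) ∈ filt d z (c + (k + 1 : ℕ)) := mem_filt (by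
      push_cast
      rcases len_σ_mul s v with h | h <;> rcases hz with rfl | rfl <;> omega)
    have a3 : T s (d v) ∈ filt d z (c + (k + 1 : ℕ)) := by
      rw [hT]
      split_ifs
      · exact add_mem a2 (Submodule.smul_mem _ _ a1)
      · exact a2
    have a4 : T s (d (σ s * v)) ∈ filt d z (c + (k + 1 : ℕ)) := by
      rw [hT, σ_mul_σ_mul]
      split_ifs
      · exact add_mem a1 (Submodule.smul_mem _ _ a2)
      · exact a1
    rw [hT]
    split_ifs
    · rw [map_add, map_smul]
      exact add_mem a4 (Submodule.smul_mem _ _ a3)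
    · exact a4
  · exact zero_mem _

lemma proj_eq_zero_of_mem_filt (hQ : ∀ (l : ℕ) (w : W L), Q l (d w) = if len w = l then d w else 0)
    {z c : ℤ} {k : ℕ} (hk : c < z * k) {y : H L} (hy : y ∈ filt d z c) : Q k y = 0 := by
  refine Submodule.span_le (p := (⊥ : Submodule ℂ (H L)).comap (Q k).toLinearMap).2 ?_ hy
  rintro _ ⟨w, hw, rfl⟩
  simp only [Set.mem_ofPred_eq] at hw
  change Q k (d w) ∈ (⊥ : Submodule ℂ (H L))
  rw [hQ, if_neg (by rintro rfl; omega)]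
  exact zero_mem _

lemma sum_generator_mem_filt
    (hT : ∀ (s : Fin L) (w : W L), T s (d w) =
      if len (σ s * w) < len w then d (σ s * w) + p • d w else d (σ s * w))
    {z : ℤ} (hz : z = 1 ∨ z = -1) {c : ℤ} {y : H L} (hy : y ∈ filt d z c) :
    (∑ s, T s) y ∈ filt d z (c + 1) := by
  rw [_root_.sum_apply]
  exact sum_mem fun s _ => generator_mem_filt hT hz s hy

lemma proj_sum_proj
    (hT : ∀ (s : Fin L) (w : W L), T s (d w) =
      if len (σ s * w) < len w then d (σ s * w) + p • d w else d (σ s * w))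
    (hQ : ∀ (l : ℕ) (w : W L), Q l (d w) = if len w = l then d w else 0)
    {z : ℤ} (hz : z = 1 ∨ z = -1) {k l : ℕ} (hk : (k : ℤ) = l + z)
    {y : H L} (hy : y ∈ filt d z (z * l)) :
    Q k ((∑ s, T s) y) = Q k ((∑ s, T s) (Q l y)) := by
  rw [← sub_eq_zero, ← map_sub, ← map_sub]
  refine Submodule.span_le (p := (⊥ : Submodule ℂ (H L)).comap
    (Q k ∘L (∑ s, T s) ∘L (1 - Q l)).toLinearMap).2 ?_ hy
  rintro _ ⟨w, hw, rfl⟩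
  simp only [Set.mem_ofPred_eq] at hw
  change Q k ((∑ s, T s) (d w - Q l (d w))) ∈ (⊥ : Submodule ℂ (H L))
  rw [hQ]
  split_ifs with h
  · simp
  · have h1 : d w ∈ filt d z (z * l - 1) := mem_filt (by rcases hz with rfl | rfl <;> omega)
    rw [sub_zero, proj_eq_zero_of_mem_filt hQ _ (sum_generator_mem_filt hT hz h1)]
    · exact zero_mem _
    · rw [hk]; rcases hz with rfl | rfl <;> omega

lemma leftShift_single (z : ℤ) (w : W L) :
    leftShift L z (Finsupp.single w 1) = ∑ s : Fin L,
      if (len (σ s * w) : ℤ) = len w + z then Finsupp.single (σ s * w) 1 else 0 := by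
  simp [leftShift]

lemma single_mem_grade {l : ℕ} {w : W L} (h : len w = l) :
    (Finsupp.single w 1 : W L →₀ ℂ) ∈ grade L l :=
  Submodule.subset_span ⟨w, h, rfl⟩

/-- Linear maps agreeing on the basis vectors of a sphere agree on its span. -/
lemma eq_of_mem_grade {M : Type*} [AddCommGroup M] [Module ℂ M] {f g : (W L →₀ ℂ) →ₗ[ℂ] M}
    {l : ℕ} (h : ∀ w : W L, len w = l → f (Finsupp.single w 1) = g (Finsupp.single w 1))
    {x : W L →₀ ℂ} (hx : x ∈ grade L l) : f x = g x := by
  refine LinearMap.eqOn_span ?_ hx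
  rintro _ ⟨w, hw, rfl⟩
  exact h w hw

lemma leftShift_mem_grade {z : ℤ} {k l : ℕ} (hk : (k : ℤ) = l + z) {x : W L →₀ ℂ}
    (hx : x ∈ grade L l) : leftShift L z x ∈ grade L k := by
  refine Submodule.span_le (p := (grade L k).comap (leftShift L z)).2 ?_ hx
  rintro _ ⟨w, hw, rfl⟩
  simp only [Set.mem_ofPred_eq] at hw
  change leftShift L z (Finsupp.single w 1) ∈ grade L k
  rw [leftShift_single]
  refine sum_mem fun s _ => ?_
  split_ifs with h
  · exact single_mem_grade (by omega)
  · exact zero_mem _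

lemma linearCombination_mem_filt {z : ℤ} {l : ℕ} {x : W L →₀ ℂ} (hx : x ∈ grade L l) :
    Finsupp.linearCombination ℂ d x ∈ filt d z (z * l) := by
  refine Submodule.span_le
    (p := (filt d z (z * l)).comap (Finsupp.linearCombination ℂ d)).2 ?_ hx
  rintro _ ⟨w, hw, rfl⟩
  simp only [Set.mem_ofPred_eq] at hw
  subst hw
  simpa using mem_filt (d := d) (z := z) le_rfl

lemma proj_linearCombination
    (hQ : ∀ (l : ℕ) (w : W L), Q l (d w) = if len w = l then d w else 0)
    {l : ℕ} {x : W L →₀ ℂ} (hx : x ∈ grade L l) :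
    Q l (Finsupp.linearCombination ℂ d x) = Finsupp.linearCombination ℂ d x := by
  refine eq_of_mem_grade (f := (Q l).toLinearMap ∘ₗ Finsupp.linearCombination ℂ d) ?_ hx
  intro w hw
  simp [hQ, hw]

lemma proj_sum_linearCombination
    (hT : ∀ (s : Fin L) (w : W L), T s (d w) =
      if len (σ s * w) < len w then d (σ s * w) + p • d w else d (σ s * w))
    (hQ : ∀ (l : ℕ) (w : W L), Q l (d w) = if len w = l then d w else 0)
    {z : ℤ} (hz : z = 1 ∨ z = -1) {k l : ℕ} (hk : (k : ℤ) = l + z)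
    {x : W L →₀ ℂ} (hx : x ∈ grade L l) :
    Q k ((∑ s, T s) (Finsupp.linearCombination ℂ d x)) =
      Finsupp.linearCombination ℂ d (leftShift L z x) := by
  refine eq_of_mem_grade (f := (Q k ∘L (∑ s, T s)).toLinearMap ∘ₗ Finsupp.linearCombination ℂ d)
    (g := Finsupp.linearCombination ℂ d ∘ₗ leftShift L z) ?_ hx
  intro w hw
  simp only [LinearMap.comp_apply, Finsupp.linearCombination_single, one_smul, leftShift_single,
    ContinuousLinearMap.coe_coe, ContinuousLinearMap.comp_apply, _root_.sum_apply,
    map_sum]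
  refine Finset.sum_congr rfl fun s _ => ?_
  have hkl : k ≠ l := by rcases hz with rfl | rfl <;> omega
  have key : Q k (T s (d w)) = Q k (d (σ s * w)) := by
    rw [hT]
    split_ifs
    · rw [map_add, map_smul, hQ k w, if_neg (by omega), smul_zero, add_zero]
    · rfl
  rw [key, hQ]
  by_cases h : len (σ s * w) = k
  · rw [if_pos h, if_pos (by omega)]; simp
  · rw [if_neg h, if_neg (by omega)]; simp

/-- The extreme component of a sphere sum applied to a vector is computed by iterated shifts. -/
lemma proj_sphereSum
    (hT : ∀ (s : Fin L) (w : W L), T s (d w) =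
      if len (σ s * w) < len w then d (σ s * w) + p • d w else d (σ s * w))
    (hTw1 : Tw 1 = 1)
    (hTw : ∀ (s : Fin L) (w : W L), len (σ s * w) < len w → Tw w = T s ∘L Tw (σ s * w))
    (hhn : ∀ n, hn n = ∑ w ∈ sphere L n, Tw w)
    (hQ : ∀ (l : ℕ) (w : W L), Q l (d w) = if len w = l then d w else 0)
    {z : ℤ} (hz : z = 1 ∨ z = -1) {l : ℕ} {x : W L →₀ ℂ} (hx : x ∈ grade L l) {y : H L}
    (hy : y ∈ filt d z (z * l)) (hxy : Q l y = Finsupp.linearCombination ℂ d x) (m : ℕ) :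
    ∀ k : ℕ, (k : ℤ) = l + z * m →
      (leftShift L z ^ m) x ∈ grade L k ∧
        Q k (hn m y) = Finsupp.linearCombination ℂ d ((leftShift L z ^ m) x) := by
  induction m with
  | zero =>
    intro k hk
    obtain rfl : k = l := by simpa using hk
    have : sphere L 0 = {1} := by ext w; simp [mem_sphere, len_eq_zero]
    refine ⟨by simpa using hx, ?_⟩
    rw [hhn, this, Finset.sum_singleton, hTw1]
    simpa using hxy
  | succ m ih =>
    intro k hk
    obtain ⟨j, hj⟩ : ∃ j : ℕ, (j : ℤ) = l + z * m := by
      rcases hz with rfl | rfl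
      · exact ⟨l + m, by push_cast; ring⟩
      · exact ⟨l - m, by push_cast at hk; omega⟩
    obtain ⟨h1, h2⟩ := ih j hj
    have hkj : (k : ℤ) = j + z := by rw [hj, hk]; push_cast; ring
    have hzj : z * l + m = z * j := by
      rw [hj]; rcases hz with rfl | rfl <;> ring
    have h3 := sum_sphereSum_sub_mem_filt hT hTw1 hTw hhn hz hy m
    have h4 := sphereSum_mem_filt hT hTw1 hTw hhn hz hy m
    rw [hzj] at h3 h4
    have h5 := proj_eq_zero_of_mem_filt (k := k) hQ
      (by rw [hkj]; rcases hz with rfl | rfl <;> omega) h3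
    rw [map_sub, sub_eq_zero] at h5
    rw [pow_succ', Module.End.mul_apply]
    refine ⟨leftShift_mem_grade hkj h1, ?_⟩
    rw [← h5, proj_sum_proj hT hQ hz hkj h4, h2, proj_sum_linearCombination hT hQ hz hkj h1]

end Filtration

section Shifts

/-- Inversion on finitely supported functions. -/
def invMap (L : ℕ) : (W L →₀ ℂ) →ₗ[ℂ] (W L →₀ ℂ) := Finsupp.lmapDomain ℂ ℂ fun w => w⁻¹

/-- The right-handed analogue of `leftShift`. -/
def rightShift (L : ℕ) (z : ℤ) : (W L →₀ ℂ) →ₗ[ℂ] (W L →₀ ℂ) :=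
  invMap L ∘ₗ leftShift L z ∘ₗ invMap L

lemma invMap_single (w : W L) (c : ℂ) :
    invMap L (Finsupp.single w c) = Finsupp.single w⁻¹ c := by
  simp [invMap, Finsupp.lmapDomain]

lemma invMap_invMap (x : W L →₀ ℂ) : invMap L (invMap L x) = x := by
  have : invMap L ∘ₗ invMap L = LinearMap.id := by
    ext w : 2
    simp [invMap_single]
  exact LinearMap.congr_fun this x

lemma invMap_mem_grade {l : ℕ} {x : W L →₀ ℂ} (hx : x ∈ grade L l) : invMap L x ∈ grade L l := by
  refine Submodule.span_le (p := (grade L l).comap (invMap L)).2 ?_ hx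
  rintro _ ⟨w, hw, rfl⟩
  change invMap L (Finsupp.single w 1) ∈ grade L l
  rw [invMap_single]
  exact single_mem_grade ((len_inv w).trans hw)

lemma linearCombination_invMap (d : W L → H L) (x : W L →₀ ℂ) :
    Finsupp.linearCombination ℂ d (invMap L x) =
      Finsupp.linearCombination ℂ (fun w => d w⁻¹) x := by
  have : Finsupp.linearCombination ℂ d ∘ₗ invMap L =
      Finsupp.linearCombination ℂ (fun w => d w⁻¹) := by
    ext w : 2
    simp [invMap_single]
  exact LinearMap.congr_fun this x

lemma rightShift_pow_apply (z : ℤ) (m : ℕ) (x : W L →₀ ℂ) :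
    (rightShift L z ^ m) x = invMap L ((leftShift L z ^ m) (invMap L x)) := by
  induction m with
  | zero => simp [invMap_invMap]
  | succ m ih =>
    rw [pow_succ', Module.End.mul_apply, ih, pow_succ', Module.End.mul_apply]
    simp [rightShift, invMap_invMap]

lemma rightShift_single (z : ℤ) (w : W L) :
    rightShift L z (Finsupp.single w 1) = ∑ s : Fin L,
      if (len (w * σ s) : ℤ) = len w + z then Finsupp.single (w * σ s) 1 else 0 := by
  simp only [rightShift, LinearMap.comp_apply, invMap_single, leftShift_single, map_sum]
  refine Finset.sum_congr rfl fun s _ => ?_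
  have : (σ s * w⁻¹)⁻¹ = w * σ s := by rw [mul_inv_rev, inv_inv, inv_σ]
  rw [← len_inv (σ s * w⁻¹), this, len_inv]
  split_ifs
  · rw [invMap_single, this]
  · simp

lemma rightShift_mem_grade {z : ℤ} {k l : ℕ} (hk : (k : ℤ) = l + z) {x : W L →₀ ℂ}
    (hx : x ∈ grade L l) : rightShift L z x ∈ grade L k :=
  invMap_mem_grade (leftShift_mem_grade hk (invMap_mem_grade hx))

lemma leftShift_neg_one_single {s : Fin L} {w : W L} (h : len (σ s * w) < len w) :
    leftShift L (-1) (Finsupp.single w 1) = Finsupp.single (σ s * w) 1 := by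
  rw [leftShift_single, Finset.sum_eq_single s]
  · rw [if_pos]
    rcases len_σ_mul s w with h' | h' <;> omega
  · intro t _ ht
    rw [if_neg]
    intro h'
    exact ht (left_descent_unique (w := w) (by omega) h)
  · simp

lemma leftShift_neg_one_leftShift_one {l : ℕ} (hl : 1 ≤ l) {x : W L →₀ ℂ} (hx : x ∈ grade L l) :
    leftShift L (-1) (leftShift L 1 x) = ((L : ℂ) - 1) • x := by
  refine eq_of_mem_grade (f := leftShift L (-1) ∘ₗ leftShift L 1)
    (g := ((L : ℂ) - 1) • LinearMap.id) ?_ hx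
  intro w hw
  obtain ⟨a, ha⟩ := exists_left_descent (w := w) (by rintro rfl; simp [len_one] at hw; omega)
  rw [LinearMap.comp_apply, leftShift_single, map_sum]
  have h : ∀ s : Fin L, leftShift L (-1)
      (if (len (σ s * w) : ℤ) = len w + 1 then Finsupp.single (σ s * w) 1 else 0) =
      Finsupp.single w 1 - if s = a then Finsupp.single w 1 else 0 := by
    intro s
    split_ifs with h1 h2 h2
    · subst h2; omega
    · rw [leftShift_neg_one_single (s := s), σ_mul_σ_mul, sub_zero]
      rw [σ_mul_σ_mul]; omega
    · simp
    · exact absurd (left_descent_unique (by rcases len_σ_mul s w with h | h <;> omega) ha) h2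
  rw [Finset.sum_congr rfl fun s _ => h s, Finset.sum_sub_distrib]
  simp [sub_smul]

lemma rightShift_neg_one_rightShift_one {l : ℕ} (hl : 1 ≤ l) {x : W L →₀ ℂ}
    (hx : x ∈ grade L l) :
    rightShift L (-1) (rightShift L 1 x) = ((L : ℂ) - 1) • x := by
  simp only [rightShift, LinearMap.comp_apply, invMap_invMap]
  rw [leftShift_neg_one_leftShift_one hl (invMap_mem_grade hx), map_smul, invMap_invMap]

/-- Left and right shifts commute on basis vectors for which the length conditions agree. -/
lemma leftShift_rightShift_comm_of {z z' : ℤ} {l : ℕ}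
    (hl : ∀ w : W L, len w = l → ∀ s t : Fin L,
      ((len (w * σ t) : ℤ) = len w + z' ∧ (len (σ s * w * σ t) : ℤ) = len w + z + z') ↔
      ((len (σ s * w) : ℤ) = len w + z ∧ (len (σ s * w * σ t) : ℤ) = len w + z + z'))
    {x : W L →₀ ℂ} (hx : x ∈ grade L l) :
    leftShift L z (rightShift L z' x) = rightShift L z' (leftShift L z x) := by
  refine eq_of_mem_grade (f := leftShift L z ∘ₗ rightShift L z')
    (g := rightShift L z' ∘ₗ leftShift L z) ?_ hx
  intro w hw
  rw [LinearMap.comp_apply, LinearMap.comp_apply, leftShift_single, rightShift_single, map_sum,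
    map_sum]
  have h1 : ∀ t : Fin L, leftShift L z
      (if (len (w * σ t) : ℤ) = len w + z' then Finsupp.single (w * σ t) 1 else 0) =
      ∑ s : Fin L, if (len (w * σ t) : ℤ) = len w + z' ∧
        (len (σ s * w * σ t) : ℤ) = len w + z + z' then Finsupp.single (σ s * w * σ t) 1 else 0 := by
    intro t
    split_ifs with h
    · rw [leftShift_single]
      refine Finset.sum_congr rfl fun s _ => ?_
      rw [← mul_assoc]
      exact if_congr (by omega) rfl rfl
    · rw [map_zero]
      exact (Finset.sum_eq_zero fun s _ => if_neg fun h' => h h'.1).symm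
  have h2 : ∀ s : Fin L, rightShift L z'
      (if (len (σ s * w) : ℤ) = len w + z then Finsupp.single (σ s * w) 1 else 0) =
      ∑ t : Fin L, if (len (σ s * w) : ℤ) = len w + z ∧
        (len (σ s * w * σ t) : ℤ) = len w + z + z' then Finsupp.single (σ s * w * σ t) 1 else 0 := by
    intro s
    split_ifs with h
    · rw [rightShift_single]
      refine Finset.sum_congr rfl fun t _ => ?_
      exact if_congr (by omega) rfl rfl
    · rw [map_zero]
      exact (Finset.sum_eq_zero fun s _ => if_neg fun h' => h h'.1).symm
  rw [Finset.sum_congr rfl fun t _ => h1 t, Finset.sum_congr rfl fun s _ => h2 s,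
    Finset.sum_comm]
  exact Finset.sum_congr rfl fun s _ => Finset.sum_congr rfl fun t _ =>
    if_congr (hl w hw s t) rfl rfl

lemma leftShift_rightShift_comm (z z' : ℤ) {l : ℕ} (hl : 2 ≤ l) {x : W L →₀ ℂ}
    (hx : x ∈ grade L l) :
    leftShift L z (rightShift L z' x) = rightShift L z' (leftShift L z x) := by
  refine leftShift_rightShift_comm_of (fun w hw s t => ?_) hx
  have := len_σ_mul_mul_σ (w := w) (by omega) s t
  omega

lemma leftShift_one_rightShift_one_comm {l : ℕ} {x : W L →₀ ℂ} (hx : x ∈ grade L l) :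
    leftShift L 1 (rightShift L 1 x) = rightShift L 1 (leftShift L 1 x) := by
  refine leftShift_rightShift_comm_of (fun w hw s t => ?_) hx
  have h1 := len_σ_mul s w
  have h2 := len_mul_σ w t
  have h3 := len_mul_σ (σ s * w) t
  have h4 := len_σ_mul s (w * σ t)
  rw [← mul_assoc] at h4
  omega

lemma len_σ_mul_σ {s t : Fin L} (h : t ≠ s) : len (σ s * σ t) = 2 := by
  rcases len_mul_σ (σ s) t with h' | h'
  · rw [h', len_σ]
  · rw [len_σ] at h'
    have h0 : (σ s * σ t : W L) = 1 := len_eq_zero.1 (by omega)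
    have h1 := eq_inv_of_mul_eq_one_left h0
    rw [inv_σ] at h1
    exact absurd (σ_injective h1).symm h

lemma leftShift_neg_one_rightShift_one {b : Fin L → ℂ} (hb : ∑ s, b s = 0) :
    leftShift L (-1) (rightShift L 1 (∑ s, b s • Finsupp.single (σ s) 1)) =
      -∑ s, b s • Finsupp.single (σ s) 1 := by
  have h : ∀ s : Fin L, leftShift L (-1) (rightShift L 1 (Finsupp.single (σ s) 1)) =
      (∑ t : Fin L, Finsupp.single (σ t) 1) - Finsupp.single (σ s) 1 := by
    intro s
    rw [rightShift_single, map_sum]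
    have h1 : ∀ t : Fin L, leftShift L (-1)
        (if (len (σ s * σ t) : ℤ) = len (σ s) + 1 then Finsupp.single (σ s * σ t) 1 else 0) =
        Finsupp.single (σ t) 1 - if t = s then Finsupp.single (σ t) 1 else 0 := by
      intro t
      by_cases e : t = s
      · subst e
        have : (σ t * σ t : W L) = 1 := (cs L).simple_mul_simple_self t
        simp only [this, len_one, len_σ]
        simp
      · rw [if_neg e, if_pos, leftShift_neg_one_single (s := s), σ_mul_σ_mul, sub_zero]
        · rw [σ_mul_σ_mul, len_σ, len_σ_mul_σ e]; norm_num
        · rw [len_σ, len_σ_mul_σ e]; norm_num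
    rw [Finset.sum_congr rfl fun t _ => h1 t, Finset.sum_sub_distrib]
    simp
  simp only [map_sum, map_smul, h, smul_sub, Finset.sum_sub_distrib]
  rw [← Finset.sum_smul, hb, zero_smul, zero_sub]

lemma rightShift_neg_one_leftShift_one {b : Fin L → ℂ} (hb : ∑ s, b s = 0) :
    rightShift L (-1) (leftShift L 1 (∑ s, b s • Finsupp.single (σ s) 1)) =
      -∑ s, b s • Finsupp.single (σ s) 1 := by
  have h : invMap L (∑ s, b s • Finsupp.single (σ s) 1) = ∑ s, b s • Finsupp.single (σ s) 1 := by
    simp only [map_sum, map_smul, invMap_single, inv_σ]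
  have h' := congrArg (invMap L) (leftShift_neg_one_rightShift_one hb)
  simp only [rightShift, LinearMap.comp_apply, h, map_neg] at h' ⊢
  rw [← h']

end Shifts

section Ladder

variable {M : Type*} [AddCommGroup M] [Module ℂ M] {G : ℕ → Submodule ℂ M}
  {Ap Am Bp Bm : M →ₗ[ℂ] M} {c : ℂ} {β : M}

lemma pow_mem_of_raises (hA : ∀ l, ∀ x ∈ G l, Ap x ∈ G (l + 1)) {l : ℕ} {x : M} (hx : x ∈ G l)
    (k : ℕ) : (Ap ^ k) x ∈ G (l + k) := by
  induction k with
  | zero => simpa using hx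
  | succ k ih =>
    rw [pow_succ', Module.End.mul_apply]
    exact hA _ _ ih

lemma lower_pow_raise_pow (hA : ∀ l, ∀ x ∈ G l, Ap x ∈ G (l + 1))
    (hc : ∀ l, 1 ≤ l → ∀ x ∈ G l, Am (Ap x) = c • x) {l : ℕ} (hl : 1 ≤ l) (k : ℕ) :
    ∀ x ∈ G l, (Am ^ k) ((Ap ^ k) x) = c ^ k • x := by
  induction k with
  | zero => simp
  | succ k ih =>
    intro x hx
    rw [pow_succ, pow_succ', Module.End.mul_apply, Module.End.mul_apply,
      hc (l + k) (by omega) _ (pow_mem_of_raises hA hx k), map_smul, ih x hx, smul_smul, pow_succ']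

lemma lower_raise_pow_succ (hB : ∀ l, ∀ x ∈ G l, Bp x ∈ G (l + 1))
    (hcomm : ∀ l, 2 ≤ l → ∀ x ∈ G l, Am (Bp x) = Bp (Am x)) (hβ : β ∈ G 1)
    (h1 : Am (Bp β) = -β) (k : ℕ) : Am ((Bp ^ (k + 1)) β) = -(Bp ^ k) β := by
  induction k with
  | zero => simpa using h1
  | succ k ih =>
    rw [pow_succ', Module.End.mul_apply,
      hcomm (1 + (k + 1)) (by omega) _ (pow_mem_of_raises hB hβ (k + 1)), ih, map_neg,
      pow_succ' Bp k, Module.End.mul_apply]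

lemma lower_pow_cross_raise_pow (hB : ∀ l, ∀ x ∈ G l, Bp x ∈ G (l + 1))
    (hcomm : ∀ l, 2 ≤ l → ∀ x ∈ G l, Am (Bp x) = Bp (Am x)) (hβ : β ∈ G 1)
    (h1 : Am (Bp β) = -β) (k j : ℕ) :
    (Am ^ k) ((Bp ^ (k + j)) β) = (-1 : ℂ) ^ k • (Bp ^ j) β := by
  induction k with
  | zero => simp
  | succ k ih =>
    rw [show k + 1 + j = k + j + 1 by ring, pow_succ Am, Module.End.mul_apply,
      lower_raise_pow_succ hB hcomm hβ h1, map_neg, ih, pow_succ]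
    simp

lemma raise_pow_comm (hA : ∀ l, ∀ x ∈ G l, Ap x ∈ G (l + 1))
    (hB : ∀ l, ∀ x ∈ G l, Bp x ∈ G (l + 1))
    (hAB : ∀ l, ∀ x ∈ G l, Ap (Bp x) = Bp (Ap x)) {l : ℕ} {x : M} (hx : x ∈ G l) (m n : ℕ) :
    (Ap ^ m) ((Bp ^ n) x) = (Bp ^ n) ((Ap ^ m) x) := by
  have h1 : ∀ n l, ∀ x ∈ G l, Ap ((Bp ^ n) x) = (Bp ^ n) (Ap x) := by
    intro n
    induction n with
    | zero => simp
    | succ n ih =>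
      intro l x hx
      rw [pow_succ, Module.End.mul_apply, ih _ _ (hB _ _ hx), hAB _ _ hx, Module.End.mul_apply]
  induction m with
  | zero => simp
  | succ m ih =>
    rw [pow_succ', Module.End.mul_apply, ih, h1 n _ _ (pow_mem_of_raises hA hx m),
      Module.End.mul_apply]

/-- The commutation relations between raising and lowering operators determine the result of
raising `β` and lowering it back. -/
lemma lower_lower_raise_raise (hA : ∀ l, ∀ x ∈ G l, Ap x ∈ G (l + 1))
    (hB : ∀ l, ∀ x ∈ G l, Bp x ∈ G (l + 1))
    (hAc : ∀ l, 1 ≤ l → ∀ x ∈ G l, Am (Ap x) = c • x)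
    (hBc : ∀ l, 1 ≤ l → ∀ x ∈ G l, Bm (Bp x) = c • x)
    (hAB : ∀ l, ∀ x ∈ G l, Ap (Bp x) = Bp (Ap x))
    (hAmB : ∀ l, 2 ≤ l → ∀ x ∈ G l, Am (Bp x) = Bp (Am x))
    (hABm : ∀ l, 2 ≤ l → ∀ x ∈ G l, Bm (Ap x) = Ap (Bm x))
    (hβ : β ∈ G 1) (h1 : Am (Bp β) = -β) (h2 : Bm (Ap β) = -β)
    {m n m' n' : ℕ} (hmn : m + n = m' + n') :
    (Am ^ m') ((Bm ^ n') ((Ap ^ m) ((Bp ^ n) β))) =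
      ((-1 : ℂ) ^ ((n : ℤ) - n').natAbs * c ^ (m + n - ((n : ℤ) - n').natAbs)) • β := by
  rw [raise_pow_comm hA hB hAB hβ]
  have hm := pow_mem_of_raises hA hβ m
  rcases le_total n' n with h | h
  · obtain ⟨k, rfl⟩ := Nat.exists_eq_add_of_le h
    obtain rfl : m' = k + m := by omega
    have hk : ((n' + k : ℕ) - n' : ℤ).natAbs = k := by omega
    rw [hk, show m + (n' + k) - k = n' + m by omega, pow_add Bp, Module.End.mul_apply,
      lower_pow_raise_pow hB hBc (l := 1 + m + k) (by omega) n' _ (pow_mem_of_raises hB hm k),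
      map_smul, ← raise_pow_comm hA hB hAB hβ, pow_add Am, Module.End.mul_apply,
      lower_pow_raise_pow hA hAc (l := 1 + k) (by omega) m _ (pow_mem_of_raises hB hβ k),
      map_smul]
    have := lower_pow_cross_raise_pow hB hAmB hβ h1 k 0
    rw [add_zero] at this
    rw [this]
    simp only [pow_zero, Module.End.one_apply, smul_smul]
    congr 1
    ring
  · obtain ⟨k, rfl⟩ := Nat.exists_eq_add_of_le h
    obtain rfl : m = k + m' := by omega
    have hk : ((n : ℤ) - (n + k : ℕ)).natAbs = k := by omega
    rw [hk, show k + m' + n - k = n + m' by omega, add_comm n k, pow_add Bm, Module.End.mul_apply,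
      lower_pow_raise_pow hB hBc (l := 1 + (k + m')) (by omega) n _ hm,
      map_smul, map_smul, lower_pow_cross_raise_pow hA hABm hβ h2, map_smul,
      lower_pow_raise_pow hA hAc le_rfl m' _ hβ]
    simp only [smul_smul]
    congr 1
    ring

end Ladder

lemma tsum_sphere {E : Type*} [AddCommMonoid E] [TopologicalSpace E] (f : W L → E) (n : ℕ) :
    ∑' w : {w : W L // len w = n}, f w = ∑ w ∈ sphere L n, f w := by
  have : ∑' w : ((sphere L n : Finset (W L)) : Set (W L)), f w = ∑ w ∈ sphere L n, f w :=
    Finset.tsum_subtype' (sphere L n) f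
  rw [← this]
  have e : ((sphere L n : Finset (W L)) : Set (W L)) = {w | len w = n} := by
    ext w; simp [mem_sphere]
  rw [e]
  rfl

lemma sum_sphere_inv {E : Type*} [AddCommMonoid E] (f : W L → E) (n : ℕ) :
    ∑ w ∈ sphere L n, f w = ∑ w ∈ sphere L n, f w⁻¹ := by
  refine Finset.sum_bij (fun w _ => w⁻¹) ?_ (fun _ _ _ _ h => inv_injective h) ?_ ?_
  · intro w hw
    rw [mem_sphere] at hw ⊢
    rw [len_inv, hw]
  · intro w hw
    rw [mem_sphere] at hw
    exact ⟨w⁻¹, by rw [mem_sphere, len_inv, hw], inv_inv w⟩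
  · intro w _
    rw [inv_inv]

lemma filt_inv (d : W L → H L) (z c : ℤ) : filt (fun w => d w⁻¹) z c = filt d z c := by
  apply le_antisymm <;> refine Submodule.span_le.2 ?_
  · rintro _ ⟨w, hw, rfl⟩
    exact mem_filt (by rw [len_inv]; exact hw)
  · rintro _ ⟨w, hw, rfl⟩
    exact Submodule.subset_span ⟨w⁻¹, by rw [Set.mem_ofPred_eq, len_inv]; exact hw, by simp⟩

lemma inner_δ (v w : W L) [Decidable (v = w)] : ⟪(δ v : H L), δ w⟫ = if v = w then 1 else 0 := by
  classical
  rw [δ, lp.inner_single_left, δ, lp.single_apply]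
  by_cases h : v = w
  · subst h; simp
  · simp [h]

/-- A vector of `V L 1` orthogonal to the sum of all generators has coefficients summing to `0`. -/
lemma exists_coeff {β : H L} (hβ : β ∈ V L 1) (hperp : ⟪β, ∑ s : Fin L, δ (σ s)⟫ = 0) :
    ∃ b : Fin L → ℂ, ∑ s, b s = 0 ∧ β = ∑ s, b s • δ (σ s) := by
  classical
  have e : {x : H L | ∃ w : W L, len w = 1 ∧ x = δ w} = Set.range fun s : Fin L => δ (σ s) := by
    ext x
    constructor
    · rintro ⟨w, hw, rfl⟩
      obtain ⟨s, rfl⟩ := len_eq_one.1 hw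
      exact ⟨s, rfl⟩
    · rintro ⟨s, rfl⟩
      exact ⟨σ s, len_σ s, rfl⟩
  rw [V, e, Submodule.mem_span_range_iff_exists_fun] at hβ
  obtain ⟨b, rfl⟩ := hβ
  refine ⟨b, ?_, rfl⟩
  simp only [sum_inner, inner_sum, inner_smul_left, inner_δ, σ_injective.eq_iff] at hperp
  simp only [mul_ite, mul_one, mul_zero, Finset.sum_ite_eq', Finset.mem_univ, if_true] at hperp
  rw [← map_sum] at hperp
  exact (map_eq_zero _).1 hperp

theorem statement11
    (L : ℕ) (hL : 3 ≤ L) (q p : ℝ) (hq : 0 < q) (hq1 : q ≤ 1)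
    (hp : p = (q - 1) / Real.sqrt q)
    (T : Fin L → H L →L[ℂ] H L)
    (hT : ∀ (s : Fin L) (w : W L),
      T s (δ w) =
        if len (σ s * w) < len w then δ (σ s * w) + (p : ℂ) • δ w else δ (σ s * w))
    (h : H L →L[ℂ] H L) (hh : h = ∑ s, T s)
    (Tw : W L → H L →L[ℂ] H L) (hTw1 : Tw 1 = 1)
    (hTwrec : ∀ (s : Fin L) (w : W L), len (σ s * w) < len w →
      Tw w = T s ∘L Tw (σ s * w))
    (hn : ℕ → H L →L[ℂ] H L)
    (hhn : ∀ n : ℕ, hn n = ∑' w : {w : W L // len w = n}, Tw (w : W L))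
    (Tr : Fin L → H L →L[ℂ] H L)
    (hTr : ∀ (s : Fin L) (w : W L),
      Tr s (δ w) =
        if len (w * σ s) < len w then δ (w * σ s) + (p : ℂ) • δ w else δ (w * σ s))
    (Rh : H L →L[ℂ] H L) (hRh : Rh = ∑ s, Tr s)
    (Twr : W L → H L →L[ℂ] H L) (hTwr1 : Twr 1 = 1)
    (hTwrrec : ∀ (s : Fin L) (w : W L), len (w * σ s) < len w →
      Twr w = Tr s ∘L Twr (w * σ s))
    (hnr : ℕ → H L →L[ℂ] H L)
    (hhnr : ∀ n : ℕ, hnr n = ∑' w : {w : W L // len w = n}, Twr (w : W L))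
    (Q : ℕ → H L →L[ℂ] H L)
    (hQ : ∀ (l : ℕ) (w : W L), Q l (δ w) = if len w = l then δ w else 0)
    (β : H L)
    (hβmem : β ∈ V L 1)
    (hβperp : ∀ y ∈ Sl L Q h Rh 1, ⟪β, y⟫ = 0)
    (m n m' n' : ℕ) (hmn : m + n = m' + n') :
    Q 1 (hn m' (hnr n' (Q (m + n + 1) (hn m (hnr n β))))) =
      (((-1 : ℂ) ^ ((n : ℤ) - (n' : ℤ)).natAbs) *
        ((L : ℂ) - 1) ^ (m + n - ((n : ℤ) - (n' : ℤ)).natAbs)) • β := by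
  have hn_eq : ∀ n, hn n = ∑ w ∈ sphere L n, Tw w := fun n => (hhn n).trans (tsum_sphere Tw n)
  have hnr_eq : ∀ n, hnr n = ∑ w ∈ sphere L n, Twr w⁻¹ := fun n =>
    (hhnr n).trans ((tsum_sphere Twr n).trans (sum_sphere_inv Twr n))
  have hmulinv : ∀ (s : Fin L) (w : W L), (σ s * w)⁻¹ = w⁻¹ * σ s := fun s w => by
    rw [mul_inv_rev, inv_σ]
  have hleninv : ∀ (s : Fin L) (w : W L), len (w⁻¹ * σ s) = len (σ s * w) := fun s w => by
    rw [← hmulinv, len_inv]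
  have hTr' : ∀ (s : Fin L) (w : W L), Tr s (δ w⁻¹) =
      if len (σ s * w) < len w then δ (σ s * w)⁻¹ + (p : ℂ) • δ w⁻¹ else δ (σ s * w)⁻¹ := by
    intro s w
    rw [hTr, hleninv, len_inv, hmulinv]
  have hTwr1' : Twr 1⁻¹ = 1 := by rw [inv_one, hTwr1]
  have hTwr' : ∀ (s : Fin L) (w : W L), len (σ s * w) < len w →
      Twr w⁻¹ = Tr s ∘L Twr (σ s * w)⁻¹ := by
    intro s w hs
    rw [hmulinv]
    exact hTwrrec s w⁻¹ (by rwa [hleninv, len_inv])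
  have hQ' : ∀ (l : ℕ) (w : W L), Q l (δ w⁻¹) = if len w = l then δ w⁻¹ else 0 := by
    intro l w
    rw [hQ, len_inv]
  have hleft := fun {z : ℤ} (hz : z = 1 ∨ z = -1) {l : ℕ} {x : W L →₀ ℂ} (hx : x ∈ grade L l)
    {y : H L} (hy : y ∈ filt δ z (z * l)) hxy m k hk =>
      proj_sphereSum hT hTw1 hTwrec hn_eq hQ hz hx hy hxy m k hk
  have hright : ∀ {z : ℤ}, (z = 1 ∨ z = -1) → ∀ {l : ℕ} {x : W L →₀ ℂ}, x ∈ grade L l →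
      ∀ m k : ℕ, (k : ℤ) = l + z * m → (rightShift L z ^ m) x ∈ grade L k ∧
        Q k (hnr m (Finsupp.linearCombination ℂ δ x)) =
          Finsupp.linearCombination ℂ δ ((rightShift L z ^ m) x) ∧
        hnr m (Finsupp.linearCombination ℂ δ x) ∈ filt δ z (z * k) := by
    intro z hz l x hx m k hk
    have e : Finsupp.linearCombination ℂ (δ : W L → H L) x =
        Finsupp.linearCombination ℂ (fun w => δ w⁻¹) (invMap L x) := by
      rw [← linearCombination_invMap, invMap_invMap]
    have hx' := invMap_mem_grade hx
    have hfilt := linearCombination_mem_filt (d := fun w : W L => δ w⁻¹) (z := z) hx'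
    obtain ⟨h1, h2⟩ := proj_sphereSum (d := fun w => δ w⁻¹) (Tw := fun w => Twr w⁻¹)
      hTr' hTwr1' hTwr' hnr_eq hQ' hz hx' hfilt (proj_linearCombination hQ' hx') m k hk
    have h3 := sphereSum_mem_filt (d := fun w => δ w⁻¹) (Tw := fun w => Twr w⁻¹)
      hTr' hTwr1' hTwr' hnr_eq hz hfilt m
    rw [rightShift_pow_apply, e, h2, linearCombination_invMap, ← filt_inv]
    refine ⟨invMap_mem_grade h1, rfl, ?_⟩
    have : z * k = z * l + m := by rw [hk]; rcases hz with rfl | rfl <;> ring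
    rwa [this]
  have hQh : Q 1 (h (δ 1)) = ∑ s : Fin L, δ (σ s) := by
    rw [hh, _root_.sum_apply, map_sum]
    refine Finset.sum_congr rfl fun s _ => ?_
    rw [hT, mul_one, if_neg (by rw [len_one]; omega), hQ, if_pos (len_σ s)]
  obtain ⟨b, hb, hβ⟩ := exists_coeff hβmem (hQh ▸ hβperp _ (Submodule.subset_span
    (Or.inl ⟨δ 1, Submodule.subset_span ⟨1, len_one, rfl⟩, rfl⟩)))
  set x : W L →₀ ℂ := ∑ s, b s • Finsupp.single (σ s) 1 with hxdef
  have hβx : β = Finsupp.linearCombination ℂ δ x := by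
    rw [hβ, hxdef, map_sum]
    simp
  have hx : x ∈ grade L 1 :=
    sum_mem fun s _ => Submodule.smul_mem _ _ (single_mem_grade (len_σ s))
  obtain ⟨r1, r2, r3⟩ := hright (Or.inl rfl) hx n (1 + n) (by push_cast; ring)
  obtain ⟨l1, l2⟩ := hleft (Or.inl rfl) r1 r3 r2 m (m + n + 1) (by push_cast; ring)
  obtain ⟨r1', r2', r3'⟩ := hright (Or.inr rfl) l1 n' (m' + 1) (by push_cast; omega)
  obtain ⟨-, l2'⟩ := hleft (Or.inr rfl) r1' r3' r2' m' 1 (by push_cast; omega)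
  rw [hβx, l2, l2', ← map_smul]
  congr 1
  exact lower_lower_raise_raise (G := grade L)
    (fun l x hx => leftShift_mem_grade (by push_cast; ring) hx)
    (fun l x hx => rightShift_mem_grade (by push_cast; ring) hx)
    (fun l hl x hx => leftShift_neg_one_leftShift_one hl hx)
    (fun l hl x hx => rightShift_neg_one_rightShift_one hl hx)
    (fun l x hx => leftShift_one_rightShift_one_comm hx)
    (fun l hl x hx => leftShift_rightShift_comm _ _ hl hx)
    (fun l hl x hx => (leftShift_rightShift_comm _ _ hl hx).symm)
    hx (leftShift_neg_one_rightShift_one hb) (rightShift_neg_one_leftShift_one hb) hmn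

end UCoxMasa
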